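/- arXiv:1406.3720 — 4 statements merged into one kernel-verified Lean document; each statement's English description precedes it below -/
import Mathlib

section
/- For the dual gradient iterates λ^{k+1} = [λ^k + W⁻¹∇d(λ^k)]_D^W started from any λ⁰ ∈ D, the dual suboptimality converges linearly: for every k ≥ 1, f* − d(λ^{k+1}) ≤ (1/2) · ρ^{k−1} · R(λ⁰)², where ρ = 4(1+κ̄)/(1+4(1+κ̄)) and R(λ⁰) = min_{λ* ∈ Λ*} ‖λ* − λ⁰‖_W. -/
noncomputable section
open Finset

/-- Euclidean inner product on `Fin m → ℝ`. -/
def ipV {m : ℕ} (x y : Fin m → ℝ) : ℝ := ∑ i, x i * y i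

/-- Euclidean norm on `Fin m → ℝ`. -/
def eNorm {m : ℕ} (x : Fin m → ℝ) : ℝ := Real.sqrt (∑ i, (x i) ^ 2)

/-- Weighted norm `‖x‖_W` for a diagonal weight vector `w` (positive entries). -/
def wNorm {m : ℕ} (w : Fin m → ℝ) (x : Fin m → ℝ) : ℝ := Real.sqrt (∑ i, w i * (x i) ^ 2)

/-- Weighted norm `‖x‖_W = √(xᵀWx)` for a matrix `W`. -/
def mNorm {m : ℕ} (W : Matrix (Fin m) (Fin m) ℝ) (x : Fin m → ℝ) : ℝ :=
  Real.sqrt (ipV x (W.mulVec x))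

/-- The set `D = ℝ^p × ℝ^q_{≥0}` inside `Fin (p+q) → ℝ`. -/
def Dpq (p q : ℕ) : Set (Fin (p + q) → ℝ) := {x | ∀ i : Fin (p + q), p ≤ (i : ℕ) → 0 ≤ x i}

/-- Componentwise (Euclidean, equivalently `W`-weighted for diagonal `W`) projection onto
`Dpq p q`: the first `p` coordinates are unchanged, positive parts on the last `q`. -/
def projDpq (p q : ℕ) (v : Fin (p + q) → ℝ) : Fin (p + q) → ℝ :=
  fun i => if (i : ℕ) < p then v i else max (v i) 0

def wip {m : ℕ} (w x y : Fin m → ℝ) : ℝ := ∑ i, w i * x i * y i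

lemma wNorm_nonneg {m : ℕ} (w x : Fin m → ℝ) : 0 ≤ wNorm w x := Real.sqrt_nonneg _

lemma wNorm_sq_eq {m : ℕ} (w x : Fin m → ℝ) (hw : ∀ i, 0 < w i) :
    (wNorm w x) ^ 2 = wip w x x := by
  unfold wNorm wip
  rw [Real.sq_sqrt (Finset.sum_nonneg fun i _ => mul_nonneg (hw i).le (sq_nonneg _))]
  exact Finset.sum_congr rfl fun i _ => by ring

lemma wip_self_nonneg {m : ℕ} (w x : Fin m → ℝ) (hw : ∀ i, 0 < w i) : 0 ≤ wip w x x := by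
  unfold wip
  exact Finset.sum_nonneg fun i _ => by
    have := mul_nonneg (hw i).le (sq_nonneg (x i)); nlinarith

lemma wip_expand {m : ℕ} (w x y : Fin m → ℝ) (a b : ℝ) :
    wip w (a • x + b • y) (a • x + b • y)
      = a ^ 2 * wip w x x + 2 * a * b * wip w x y + b ^ 2 * wip w y y := by
  simp only [wip, Finset.mul_sum, ← Finset.sum_add_distrib]
  exact Finset.sum_congr rfl fun i _ => by simp; ring

lemma proj_vi {m : ℕ} (w : Fin m → ℝ) (hw : ∀ i, 0 < w i) (D : Set (Fin m → ℝ))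
    (hD : Convex ℝ D) (p z s : Fin m → ℝ) (hp : p ∈ D) (hs : s ∈ D)
    (hmin : ∀ s ∈ D, wNorm w (p - z) ≤ wNorm w (s - z)) : 0 ≤ wip w (p - z) (s - p) := by
  have key : ∀ t : ℝ, 0 < t → t ≤ 1 →
      0 ≤ 2 * wip w (p - z) (s - p) + t * wip w (s - p) (s - p) := by
    intro t ht ht1
    have hmem : p + t • (s - p) ∈ D := hD.add_smul_sub_mem hp hs ⟨ht.le, ht1⟩
    have h := hmin _ hmem
    have h2 : (wNorm w (p - z)) ^ 2 ≤ (wNorm w (p + t • (s - p) - z)) ^ 2 :=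
      pow_le_pow_left₀ (Real.sqrt_nonneg _) h 2
    rw [wNorm_sq_eq w _ hw, wNorm_sq_eq w _ hw] at h2
    have e : p + t • (s - p) - z = (1 : ℝ) • (p - z) + t • (s - p) := by
      rw [one_smul]; abel
    rw [e, wip_expand] at h2
    by_contra hc
    push Not at hc
    nlinarith
  by_contra hc
  push Not at hc
  have hn := wip_self_nonneg w (s - p) hw
  set A := wip w (p - z) (s - p)
  set B := wip w (s - p) (s - p)
  have h1 : 0 < B - A := by linarith
  have h := key (-A / (B - A)) (div_pos (by linarith) h1) (by rw [div_le_one h1]; linarith)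
  have : -A / (B - A) * B ≤ -A := by
    rw [div_mul_eq_mul_div, div_le_iff₀ h1]; nlinarith
  linarith

lemma conc_grad {m : ℕ} (d : (Fin m → ℝ) → ℝ) (hconc : ConcaveOn ℝ Set.univ d)
    (hdiff : Differentiable ℝ d) (x s : Fin m → ℝ) :
    d s ≤ d x + fderiv ℝ d x (s - x) := by
  have hc : ConcaveOn ℝ Set.univ (d ∘ (AffineMap.lineMap x s : ℝ →ᵃ[ℝ] (Fin m → ℝ))) := by
    simpa using hconc.comp_affineMap (AffineMap.lineMap x s : ℝ →ᵃ[ℝ] (Fin m → ℝ))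
  have hd : HasDerivAt (d ∘ (AffineMap.lineMap x s : ℝ →ᵃ[ℝ] (Fin m → ℝ)))
      (fderiv ℝ d x (s - x)) 0 := by
    have h1 : HasDerivAt (AffineMap.lineMap x s : ℝ → (Fin m → ℝ)) (s - x) 0 :=
      AffineMap.hasDerivAt_lineMap
    have h2 : HasFDerivAt d (fderiv ℝ d x) (AffineMap.lineMap x s (0 : ℝ)) := by
      simpa using (hdiff x).hasFDerivAt
    exact h2.comp_hasDerivAt 0 h1
  have := hc.slope_le_of_hasDerivAt (Set.mem_univ 0) (Set.mem_univ 1) one_pos hd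
  simp [slope_def_field] at this
  simp
  linarith

/-- linear convergence of dual suboptimality for the distributed
dual gradient method: for `k ≥ 1`, `f* − d(λ^{k+1}) ≤ (1/2) ρ^{k−1} R(λ⁰)²`. -/
theorem dual_suboptimality_linear
    (m : ℕ) (D : Set (Fin m → ℝ)) (hDne : D.Nonempty) (hDcl : IsClosed D) (hDconv : Convex ℝ D)
    (W : Fin m → ℝ) (hW : ∀ i, 0 < W i)
    (d : (Fin m → ℝ) → ℝ) (hconc : ConcaveOn ℝ Set.univ d)
    (gradD : (Fin m → ℝ) → (Fin m → ℝ))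
    (hdiff : Differentiable ℝ d)
    (hgrad : ∀ x v, fderiv ℝ d x v = ipV (gradD x) v)
    (hdescent : ∀ lam ∈ D, ∀ mu ∈ D,
      d lam ≥ d mu + ipV (gradD mu) (lam - mu) - 1 / 2 * (wNorm W (lam - mu)) ^ 2)
    (projD : (Fin m → ℝ) → (Fin m → ℝ))
    (hprojD : ∀ x, projD x ∈ D ∧ ∀ s ∈ D, wNorm W (projD x - x) ≤ wNorm W (s - x))
    (fstar : ℝ) (Lstar : Set (Fin m → ℝ)) (hLsub : Lstar ⊆ D) (hLne : Lstar.Nonempty)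
    (hval : ∀ l ∈ Lstar, d l = fstar) (hub : ∀ mu ∈ D, d mu ≤ fstar)
    (projLs : (Fin m → ℝ) → (Fin m → ℝ))
    (hprojLs : ∀ x, projLs x ∈ Lstar ∧ ∀ s ∈ Lstar, wNorm W (projLs x - x) ≤ wNorm W (s - x))
    (kb : ℝ) (hkb : 0 < kb)
    (heb : ∀ lam ∈ D, wNorm W (lam - projLs lam) ≤
      kb * wNorm W (projD (lam + fun i => (W i)⁻¹ * gradD lam i) - lam))
    (lam : ℕ → Fin m → ℝ) (hlam0 : lam 0 ∈ D)
    (hiter : ∀ k, lam (k + 1) = projD (lam k + fun i => (W i)⁻¹ * gradD (lam k) i))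
    (ρ R : ℝ) (hρ : ρ = 4 * (1 + kb) / (1 + 4 * (1 + kb)))
    (hR : R = sInf ((fun l => wNorm W (l - lam 0)) '' Lstar)) :
    ∀ k : ℕ, 1 ≤ k → fstar - d (lam (k + 1)) ≤ 1 / 2 * ρ ^ (k - 1) * R ^ 2 := by
  have hmem : ∀ k, lam k ∈ D := by
    intro k
    cases k with
    | zero => exact hlam0
    | succ k => rw [hiter]; exact (hprojD _).1
  have main : ∀ k, ∀ s ∈ D, d s - d (lam (k + 1)) ≤
      wip W (lam (k + 1) - lam k) (s - lam k)
        - 1 / 2 * wip W (lam (k + 1) - lam k) (lam (k + 1) - lam k) := by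
    intro k s hs
    have h1 := proj_vi W hW D hDconv _ _ s (hprojD (lam k + fun i => (W i)⁻¹ * gradD (lam k) i)).1
      hs (hprojD _).2
    rw [← hiter] at h1
    have h2 := hdescent _ (hmem (k + 1)) _ (hmem k)
    rw [wNorm_sq_eq W _ hW] at h2
    have h3 := conc_grad d hconc hdiff (lam k) s
    rw [hgrad] at h3
    have h4 : wip W (lam (k + 1) - (lam k + fun i => (W i)⁻¹ * gradD (lam k) i))
        (s - lam (k + 1)) = wip W (lam (k + 1) - lam k) (s - lam k)
        - wip W (lam (k + 1) - lam k) (lam (k + 1) - lam k)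
        - ipV (gradD (lam k)) (s - lam k) + ipV (gradD (lam k)) (lam (k + 1) - lam k) := by
      simp only [wip, ipV, ← Finset.sum_sub_distrib, ← Finset.sum_add_distrib]
      refine Finset.sum_congr rfl fun i _ => ?_
      have := (hW i).ne'
      simp
      field_simp
      ring
    linarith
  have dec : ∀ k, 1 / 2 * wip W (lam (k + 1) - lam k) (lam (k + 1) - lam k)
      ≤ d (lam (k + 1)) - d (lam k) := by
    intro k
    have h := main k _ (hmem k)
    have : wip W (lam (k + 1) - lam k) (lam k - lam k) = 0 := by simp [wip]
    linarith
  have contr : ∀ k, fstar - d (lam (k + 1)) ≤ ρ * (fstar - d (lam k)) := by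
    intro k
    obtain ⟨hs, -⟩ := hprojLs (lam k)
    have h := main k _ (hLsub hs)
    rw [hval _ hs] at h
    have he := heb _ (hmem k)
    rw [← hiter] at he
    have he2 := pow_le_pow_left₀ (wNorm_nonneg W _) he 2
    rw [mul_pow, wNorm_sq_eq W _ hW, wNorm_sq_eq W _ hW] at he2
    have hx := wip_self_nonneg W (kb • (lam (k + 1) - lam k) + (1 : ℝ) • (lam k - projLs (lam k))) hW
    rw [wip_expand] at hx
    have hneg : wip W (lam (k + 1) - lam k) (projLs (lam k) - lam k)
        = - wip W (lam (k + 1) - lam k) (lam k - projLs (lam k)) := by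
      simp only [wip, ← Finset.sum_neg_distrib]
      exact Finset.sum_congr rfl fun i _ => by simp; ring
    rw [hneg] at h
    have hU := wip_self_nonneg W (lam (k + 1) - lam k) hW
    have hdk := dec k
    set U := wip W (lam (k + 1) - lam k) (lam (k + 1) - lam k)
    set C := wip W (lam (k + 1) - lam k) (lam k - projLs (lam k))
    have hC : -C ≤ kb * U := by
      have : 0 ≤ kb * (kb * U + C) := by nlinarith
      have := nonneg_of_mul_nonneg_right this hkb
      linarith
    rw [hρ, div_mul_eq_mul_div, le_div_iff₀ (by linarith)]
    nlinarith [mul_nonneg hkb.le hU, mul_le_mul_of_nonneg_left hdk (by linarith : 0 ≤ 1 + kb)]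
  have hρ0 : 0 ≤ ρ := by rw [hρ]; positivity
  have base : fstar - d (lam 1) ≤ 1 / 2 * R ^ 2 := by
    obtain ⟨hs, hmin⟩ := hprojLs (lam 0)
    have h := main 0 _ (hLsub hs)
    rw [hval _ hs] at h
    have hRle : wNorm W (projLs (lam 0) - lam 0) ≤ R := by
      rw [hR]
      refine le_csInf (hLne.image _) ?_
      rintro _ ⟨l, hl, rfl⟩
      exact hmin l hl
    have h2 := pow_le_pow_left₀ (wNorm_nonneg W _) hRle 2
    rw [wNorm_sq_eq W _ hW] at h2
    have hx := wip_self_nonneg W ((1 : ℝ) • (lam (0 + 1) - lam 0)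
      + (-1 : ℝ) • (projLs (lam 0) - lam 0)) hW
    rw [wip_expand] at hx
    simp only [zero_add] at *
    linarith
  intro k hk
  induction k, hk using Nat.le_induction with
  | base =>
    have h1 := dec 1
    have h2 := wip_self_nonneg W (lam (1 + 1) - lam 1) hW
    simp only [Nat.sub_self, pow_zero]
    linarith
  | succ n hn ih =>
    have h := contr (n + 1)
    obtain ⟨j, rfl⟩ : ∃ j, n = j + 1 := ⟨n - 1, by omega⟩
    simp only [Nat.add_sub_cancel] at ih ⊢
    have h2 := mul_le_mul_of_nonneg_left ih hρ0
    rw [pow_succ]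
    linarith
end
end

section
/- For the dual gradient iterates λ^{k+1} = [λ^k + W⁻¹∇d(λ^k)]_D^W started from λ⁰ ∈ D, with z^k = argmin_{z∈ℝⁿ} L(z, λ^k), the last primal iterate converges linearly to the primal optimal solution z*: for every k ≥ 2, ‖z^k − z*‖ ≤ √(1/σ_f) · ρ^{(k−2)/2} · R(λ⁰), where ρ = 4(1+κ̄)/(1+4(1+κ̄)) and R(λ⁰) = min_{λ* ∈ Λ*} ‖λ* − λ⁰‖_W. -/
noncomputable section
open Finset

lemma eNorm_sq' {m : ℕ} (x : Fin m → ℝ) : (eNorm x) ^ 2 = ∑ i, (x i) ^ 2 :=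
  Real.sq_sqrt (Finset.sum_nonneg fun i _ => sq_nonneg _)

lemma wNorm_sq' {m : ℕ} (w : Fin m → ℝ) (hw : ∀ i, 0 < w i) (x : Fin m → ℝ) :
    (wNorm w x) ^ 2 = ∑ i, w i * (x i) ^ 2 :=
  Real.sq_sqrt (Finset.sum_nonneg fun i _ => mul_nonneg (hw i).le (sq_nonneg _))

lemma ipV_add_right {m : ℕ} (x y z : Fin m → ℝ) : ipV x (y + z) = ipV x y + ipV x z := by
  simp only [ipV, Pi.add_apply, mul_add, Finset.sum_add_distrib]

lemma ipV_sub_right {m : ℕ} (x y z : Fin m → ℝ) : ipV x (y - z) = ipV x y - ipV x z := by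
  simp only [ipV, Pi.sub_apply, mul_sub, Finset.sum_sub_distrib]

lemma ipV_smul_right {m : ℕ} (t : ℝ) (x y : Fin m → ℝ) : ipV x (t • y) = t * ipV x y := by
  simp only [ipV, Pi.smul_apply, smul_eq_mul, Finset.mul_sum]
  exact Finset.sum_congr rfl fun i _ => by ring

lemma ipV_comm' {m : ℕ} (x y : Fin m → ℝ) : ipV x y = ipV y x := by
  simp only [ipV, mul_comm]

lemma strong_aux {n m : ℕ} (σf : ℝ) (hσf : 0 < σf) (f : (Fin n → ℝ) → ℝ)
    (hconv : ConvexOn ℝ Set.univ (fun z => f z - σf / 2 * (eNorm z) ^ 2))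
    (G : Matrix (Fin m) (Fin n) ℝ) (g l : Fin m → ℝ) (zm z : Fin n → ℝ)
    (hmin : ∀ y, f zm + ipV l (G.mulVec zm - g) ≤ f y + ipV l (G.mulVec y - g)) :
    σf / 2 * (eNorm (zm - z)) ^ 2 ≤
      f z + ipV l (G.mulVec z - g) - (f zm + ipV l (G.mulVec zm - g)) := by
  have key : ∀ t : ℝ, 0 < t → t < 1 → (1 - t) * (σf / 2 * (eNorm (zm - z)) ^ 2) ≤
      f z + ipV l (G.mulVec z - g) - (f zm + ipV l (G.mulVec zm - g)) := by
    intro t h0 h1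
    have hc := hconv.2 (Set.mem_univ zm) (Set.mem_univ z) (sub_nonneg.2 h1.le) h0.le
      (by ring : (1 - t) + t = 1)
    have hm := hmin ((1 - t) • zm + t • z)
    simp only [smul_eq_mul] at hc
    simp only [Matrix.mulVec_add, Matrix.mulVec_smul, ipV_sub_right, ipV_add_right,
      ipV_smul_right] at hm ⊢
    have hN : (eNorm ((1 - t) • zm + t • z)) ^ 2 =
        (1 - t) * (eNorm zm) ^ 2 + t * (eNorm z) ^ 2 - t * (1 - t) * (eNorm (zm - z)) ^ 2 := by
      simp only [eNorm_sq', Finset.mul_sum, ← Finset.sum_add_distrib, ← Finset.sum_sub_distrib]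
      refine Finset.sum_congr rfl fun i _ => ?_
      simp only [Pi.add_apply, Pi.smul_apply, Pi.sub_apply, smul_eq_mul]
      ring
    rw [hN] at hc
    refine le_of_mul_le_mul_left ?_ h0
    nlinarith
  have hb : 0 ≤ σf / 2 * (eNorm (zm - z)) ^ 2 := by positivity
  generalize σf / 2 * (eNorm (zm - z)) ^ 2 = b at *
  generalize f z + ipV l (G.mulVec z - g) - (f zm + ipV l (G.mulVec zm - g)) = a at *
  by_contra hlt
  push Not at hlt
  have ha : 0 ≤ a := by
    have := key (1/2) (by norm_num) (by norm_num)
    linarith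
  have hbp : 0 < b := by linarith
  have := key ((b - a) / (2 * b)) (by apply div_pos <;> linarith)
    (by rw [div_lt_one (by linarith)]; linarith)
  have e : (1 - (b - a) / (2 * b)) * b = (a + b) / 2 := by field_simp; ring
  rw [e] at this
  linarith

lemma proj_mem (p q : ℕ) (v : Fin (p + q) → ℝ) : projDpq p q v ∈ Dpq p q := by
  intro i hi
  simp [projDpq, not_lt.2 hi]

lemma proj_opt (p q : ℕ) (W gr x l : Fin (p + q) → ℝ) (hW : ∀ i, 0 < W i) (hl : l ∈ Dpq p q)
    (y : Fin (p + q) → ℝ) (hy : y = projDpq p q (x + fun i => (W i)⁻¹ * gr i)) :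
    ipV gr (l - y) ≤ ∑ i, W i * (y i - x i) * (l i - y i) := by
  unfold ipV
  refine Finset.sum_le_sum fun i _ => ?_
  have hWi := hW i
  simp only [Pi.sub_apply]
  have hyi : y i = if (i : ℕ) < p then x i + (W i)⁻¹ * gr i else max (x i + (W i)⁻¹ * gr i) 0 := by
    rw [hy]; rfl
  have hg : gr i = W i * (x i + (W i)⁻¹ * gr i - x i) := by field_simp; ring
  generalize x i + (W i)⁻¹ * gr i = v at *
  have : (v - y i) * (l i - y i) ≤ 0 := by
    split_ifs at hyi with h
    · rw [hyi]; simp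
    · have hli := hl i (not_lt.1 h)
      rcases le_total v 0 with hv | hv
      · rw [max_eq_right hv] at hyi
        rw [hyi]; nlinarith
      · rw [max_eq_left hv] at hyi
        rw [hyi]; simp
  rw [hg]
  nlinarith

/-- linear convergence of the last primal iterate to the primal optimum:
for `k ≥ 2`, `‖z^k − z*‖ ≤ √(1/σ_f) ρ^{(k−2)/2} R(λ⁰)`. -/
theorem primal_iterate_linear_convergence
    (n p q : ℕ) (σf : ℝ) (hσf : 0 < σf)
    (f : (Fin n → ℝ) → ℝ)
    (hconv : ConvexOn ℝ Set.univ (fun z => f z - σf / 2 * (eNorm z) ^ 2))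
    (hfdiff : Differentiable ℝ f)
    (G : Matrix (Fin (p + q)) (Fin n) ℝ) (g : Fin (p + q) → ℝ)
    (Lag : (Fin n → ℝ) → (Fin (p + q) → ℝ) → ℝ)
    (hLag : ∀ z lam, Lag z lam = f z + ipV lam (G.mulVec z - g))
    (zmin : (Fin (p + q) → ℝ) → (Fin n → ℝ))
    (hzmin : ∀ lam z, Lag (zmin lam) lam ≤ Lag z lam)
    (d : (Fin (p + q) → ℝ) → ℝ) (hd : ∀ lam, d lam = Lag (zmin lam) lam)
    (gradD : (Fin (p + q) → ℝ) → (Fin (p + q) → ℝ))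
    (hgradD : ∀ lam, gradD lam = G.mulVec (zmin lam) - g)
    (W : Fin (p + q) → ℝ) (hW : ∀ i, 0 < W i)
    (hdescent : ∀ lam ∈ Dpq p q, ∀ mu ∈ Dpq p q,
      d lam ≥ d mu + ipV (gradD mu) (lam - mu) - 1 / 2 * (wNorm W (lam - mu)) ^ 2)
    (fstar : ℝ) (Lstar : Set (Fin (p + q) → ℝ))
    (hLstar : ∀ l, l ∈ Lstar ↔ (l ∈ Dpq p q ∧ ∀ mu ∈ Dpq p q, d mu ≤ d l))
    (hLne : Lstar.Nonempty)
    (zstar : Fin n → ℝ) (hfstar : fstar = f zstar)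
    (hzfeas : ∀ l ∈ Dpq p q, ipV l (G.mulVec zstar - g) ≤ 0)
    (hzstar : ∀ l ∈ Lstar, zstar = zmin l ∧ d l = fstar)
    (projLs : (Fin (p + q) → ℝ) → (Fin (p + q) → ℝ))
    (hprojLs : ∀ x, projLs x ∈ Lstar ∧ ∀ s ∈ Lstar, wNorm W (projLs x - x) ≤ wNorm W (s - x))
    (kb : ℝ) (hkb : 0 < kb)
    (heb : ∀ lam ∈ Dpq p q, wNorm W (lam - projLs lam) ≤
      kb * wNorm W (projDpq p q (lam + fun i => (W i)⁻¹ * gradD lam i) - lam))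
    (lam : ℕ → Fin (p + q) → ℝ) (hlam0 : lam 0 ∈ Dpq p q)
    (hiter : ∀ k, lam (k + 1) = projDpq p q (lam k + fun i => (W i)⁻¹ * gradD (lam k) i))
    (ρ R : ℝ) (hρ : ρ = 4 * (1 + kb) / (1 + 4 * (1 + kb)))
    (hR : R = sInf ((fun l => wNorm W (l - lam 0)) '' Lstar)) :
    ∀ k : ℕ, 2 ≤ k →
      eNorm (zmin (lam k) - zstar) ≤ Real.sqrt (1 / σf) * Real.sqrt (ρ ^ (k - 2)) * R := by
  have hdex : ∀ l, d l = f (zmin l) + ipV l (G.mulVec (zmin l) - g) := fun l => by rw [hd, hLag]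
  have hmin : ∀ l y, f (zmin l) + ipV l (G.mulVec (zmin l) - g) ≤ f y + ipV l (G.mulVec y - g) := by
    intro l y
    rw [← hLag, ← hLag]; exact hzmin l y
  have hD : ∀ k, lam k ∈ Dpq p q := by
    intro k
    cases k with
    | zero => exact hlam0
    | succ k => rw [hiter]; exact proj_mem p q _
  have hconc : ∀ m l, d m ≤ d l + ipV (gradD l) (m - l) := by
    intro m l
    have := hmin m (zmin l)
    rw [hdex m, hdex l, hgradD, ipV_comm' _ (m - l)]
    have e : ipV (m - l) (G.mulVec (zmin l) - g) =
        ipV m (G.mulVec (zmin l) - g) - ipV l (G.mulVec (zmin l) - g) := by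
      rw [ipV_comm' (m - l), ipV_sub_right, ipV_comm' m, ipV_comm' l]
    linarith
  -- one-step inequality
  have hstep : ∀ k, ∀ l ∈ Dpq p q, d l - d (lam (k + 1)) ≤
      ∑ i, W i * (lam (k + 1) i - lam k i) * (l i - lam (k + 1) i)
        + 1 / 2 * ∑ i, W i * (lam (k + 1) i - lam k i) ^ 2 := by
    intro k l hl
    have h1 := hconc l (lam k)
    have h2 := hdescent _ (hD (k + 1)) _ (hD k)
    have h3 := proj_opt p q W (gradD (lam k)) (lam k) l hW hl _ (hiter k)
    rw [wNorm_sq' W hW] at h2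
    simp only [ipV_sub_right, Pi.sub_apply] at h1 h2 h3
    linarith
  have hkinc : ∀ k, 1 / 2 * ∑ i, W i * (lam (k + 1) i - lam k i) ^ 2 ≤
      d (lam (k + 1)) - d (lam k) := by
    intro k
    have h2 := hdescent _ (hD (k + 1)) _ (hD k)
    have h3 := proj_opt p q W (gradD (lam k)) (lam k) _ hW (hD k) _ (hiter k)
    have e : ∑ i, W i * (lam (k + 1) i - lam k i) * (lam k i - lam (k + 1) i) =
        - ∑ i, W i * (lam (k + 1) i - lam k i) ^ 2 := by
      rw [← Finset.sum_neg_distrib]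
      exact Finset.sum_congr rfl fun i _ => by ring
    rw [wNorm_sq' W hW] at h2
    simp only [ipV_sub_right, Pi.sub_apply] at h2 h3
    linarith
  have hgap0 : ∀ k, 0 ≤ fstar - d (lam k) := by
    intro k
    obtain ⟨l, hl⟩ := hLne
    have := ((hLstar l).1 hl).2 _ (hD k)
    have := (hzstar l hl).2
    linarith
  have hRval : R = wNorm W (projLs (lam 0) - lam 0) := by
    rw [hR]
    refine IsLeast.csInf_eq ⟨⟨_, (hprojLs (lam 0)).1, rfl⟩, ?_⟩
    rintro _ ⟨s, hs, rfl⟩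
    exact (hprojLs (lam 0)).2 s hs
  have hR0 : 0 ≤ R := by rw [hRval]; exact Real.sqrt_nonneg _
  have hgap1 : fstar - d (lam 1) ≤ 1 / 2 * R ^ 2 := by
    have hm := (hprojLs (lam 0)).1
    have h1 := hstep 0 _ ((hLstar _).1 hm).1
    rw [(hzstar _ hm).2] at h1
    rw [hRval, wNorm_sq' W hW]
    refine h1.trans ?_
    rw [Finset.mul_sum, Finset.mul_sum, ← Finset.sum_add_distrib]
    refine Finset.sum_le_sum fun i _ => ?_
    simp only [Pi.sub_apply, zero_add]
    nlinarith [mul_nonneg (hW i).le (sq_nonneg (projLs (lam 0) i - lam 1 i))]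
  have hρ0 : 0 ≤ ρ := by rw [hρ]; positivity
  have hρ1 : ρ ≤ 1 := by
    rw [hρ, div_le_one (by positivity)]; linarith
  have hrate : ∀ k, fstar - d (lam (k + 1)) ≤ ρ * (fstar - d (lam k)) := by
    intro k
    have hm := (hprojLs (lam k)).1
    have h1 := hstep k _ ((hLstar _).1 hm).1
    rw [(hzstar _ hm).2] at h1
    have h2 := hkinc k
    have h3 := heb _ (hD k)
    rw [← hiter k] at h3
    have h4 : (wNorm W (lam k - projLs (lam k))) ^ 2 ≤ kb ^ 2 * (wNorm W (lam (k+1) - lam k)) ^ 2 := by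
      rw [← mul_pow]
      exact pow_le_pow_left₀ (Real.sqrt_nonneg _) h3 2
    rw [wNorm_sq' W hW, wNorm_sq' W hW] at h4
    simp only [Pi.sub_apply] at h4
    set S := ∑ i, W i * (lam (k + 1) i - lam k i) ^ 2 with hS
    have hS0 : 0 ≤ S := Finset.sum_nonneg fun i _ => mul_nonneg (hW i).le (sq_nonneg _)
    have h5 : ∑ i, W i * (lam (k + 1) i - lam k i) * (projLs (lam k) i - lam (k + 1) i) ≤
        kb / 2 * S + 1 / (2 * kb) * (∑ i, W i * (lam k i - projLs (lam k) i) ^ 2) - S := by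
      rw [hS, Finset.mul_sum, Finset.mul_sum, ← Finset.sum_add_distrib, ← Finset.sum_sub_distrib]
      refine Finset.sum_le_sum fun i _ => ?_
      have e : kb / 2 * (W i * (lam (k + 1) i - lam k i) ^ 2) +
          1 / (2 * kb) * (W i * (lam k i - projLs (lam k) i) ^ 2)
          - W i * (lam (k + 1) i - lam k i) ^ 2
          - W i * (lam (k + 1) i - lam k i) * (projLs (lam k) i - lam (k + 1) i)
          = W i / (2 * kb) * (kb * (lam (k + 1) i - lam k i)
            + (lam k i - projLs (lam k) i)) ^ 2 := by
        field_simp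
        ring
      have : 0 ≤ W i / (2 * kb) * (kb * (lam (k + 1) i - lam k i)
            + (lam k i - projLs (lam k) i)) ^ 2 :=
        mul_nonneg (div_nonneg (hW i).le (by linarith)) (sq_nonneg _)
      linarith
    have h6 : 1 / (2 * kb) * (∑ i, W i * (lam k i - projLs (lam k) i) ^ 2) ≤ kb / 2 * S := by
      calc _ ≤ 1 / (2 * kb) * (kb ^ 2 * S) := by gcongr
        _ = kb / 2 * S := by field_simp
    rw [hρ, div_mul_eq_mul_div, le_div_iff₀ (by positivity)]
    have h7 : fstar - d (lam (k + 1)) ≤ kb * S - 1 / 2 * S := by linarith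
    have h8 : 4 * (1 + kb) * (1 / 2 * S) ≤ 4 * (1 + kb) * (d (lam (k + 1)) - d (lam k)) := by
      gcongr
    nlinarith [mul_nonneg hkb.le hS0]
  have hgap : ∀ j, fstar - d (lam (j + 1)) ≤ ρ ^ j * (1 / 2 * R ^ 2) := by
    intro j
    induction j with
    | zero => simpa using hgap1
    | succ j ih =>
      calc _ ≤ ρ * (fstar - d (lam (j + 1))) := hrate (j + 1)
        _ ≤ ρ * (ρ ^ j * (1 / 2 * R ^ 2)) := by gcongr
        _ = _ := by ring
  intro k hk
  obtain ⟨j, rfl⟩ := Nat.exists_eq_add_of_le hk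
  have hj : 2 + j - 2 = j := by omega
  rw [hj]
  have hg := hgap (j + 1)
  rw [show j + 1 + 1 = 2 + j by ring] at hg
  have hs := strong_aux σf hσf f hconv G g (lam (2 + j)) (zmin (lam (2 + j))) zstar (hmin _)
  rw [← hdex, ← hfstar] at hs
  have hfe := hzfeas _ (hD (2 + j))
  have hpow : ρ ^ (j + 1) ≤ ρ ^ j := pow_le_pow_of_le_one hρ0 hρ1 (Nat.le_succ j)
  have hfin : (eNorm (zmin (lam (2 + j)) - zstar)) ^ 2 ≤ 1 / σf * ρ ^ j * R ^ 2 := by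
    have h9 : ρ ^ (j + 1) * (1 / 2 * R ^ 2) ≤ ρ ^ j * (1 / 2 * R ^ 2) := by gcongr
    rw [div_mul_eq_mul_div, div_mul_eq_mul_div, le_div_iff₀ hσf]
    linarith
  refine (sq_le_sq₀ (Real.sqrt_nonneg _) (by positivity)).1 ?_
  rw [mul_pow, mul_pow, Real.sq_sqrt (show 0 ≤ 1 / σf by positivity), Real.sq_sqrt (show 0 ≤ ρ ^ j by positivity)]
  exact hfin
end
end

section
/- (Fejér monotonicity of the dual gradient iterates) Let D ⊆ ℝ^m be a nonempty closed convex set, W an m×m symmetric positive definite matrix, and d : ℝ^m → ℝ concave and differentiable, satisfying the W-descent inequality on D: d(λ) ≥ d(μ) + ⟨∇d(μ), λ − μ⟩ − (1/2)‖λ − μ‖²_W for all λ, μ ∈ D. Let λ* be any maximizer of d over D. Then for every λ ∈ D, the point λ⁺ = [λ + W⁻¹∇d(λ)]_D^W satisfies ‖λ⁺ − λ*‖²_W ≤ ‖λ − λ*‖²_W + 2(d(λ⁺) − d(λ*)) ≤ ‖λ − λ*‖²_W; in particular ‖λ⁺ − λ*‖_W ≤ ‖λ − λ*‖_W. -/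
noncomputable section
open Finset

lemma aux_ip_dot {m : ℕ} (x y : Fin m → ℝ) : ipV x y = x ⬝ᵥ y := rfl

lemma aux_sq {m : ℕ} {W : Matrix (Fin m) (Fin m) ℝ} (hW : W.PosDef) (x : Fin m → ℝ) :
    (mNorm W x) ^ 2 = x ⬝ᵥ W.mulVec x := by
  unfold mNorm
  rw [Real.sq_sqrt]
  · rfl
  · have := hW.posSemidef.dotProduct_mulVec_nonneg x
    simpa [aux_ip_dot] using this

lemma aux_symm {m : ℕ} {W : Matrix (Fin m) (Fin m) ℝ} (hW : W.IsSymm) (x y : Fin m → ℝ) :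
    x ⬝ᵥ W.mulVec y = y ⬝ᵥ W.mulVec x := by
  rw [Matrix.dotProduct_mulVec, ← Matrix.mulVec_transpose, hW.eq, dotProduct_comm]

lemma aux_var {b q : ℝ} (h : ∀ t : ℝ, 0 < t → t ≤ 1 → 0 ≤ 2 * t * b + t ^ 2 * q) : 0 ≤ b := by
  by_contra hb
  push Not at hb
  have hq : 0 < |q| - b := by have := abs_nonneg q; linarith
  have ht : 0 < -b / (|q| - b) := div_pos (by linarith) hq
  have h1 : -b / (|q| - b) ≤ 1 := by
    rw [div_le_one hq]; linarith [abs_nonneg q]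
  have h2 := h _ ht h1
  set t := -b / (|q| - b) with htd
  have h3 : t * (|q| - b) = -b := by rw [htd]; field_simp
  have h4 : 0 ≤ 2 * b + t * q := by
    have : 0 ≤ t * (2 * b + t * q) := by linarith [h2, (by ring : t * (2 * b + t * q) = 2 * t * b + t ^ 2 * q)]
    exact nonneg_of_mul_nonneg_right this ht
  have h5 : t * q ≤ t * |q| := mul_le_mul_of_nonneg_left (le_abs_self q) ht.le
  have h6 : t * b < 0 := mul_neg_of_pos_of_neg ht hb
  nlinarith

lemma aux_conc {m : ℕ} {d : (Fin m → ℝ) → ℝ} (hconc : ConcaveOn ℝ Set.univ d)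
    (hdiff : Differentiable ℝ d) (x s : Fin m → ℝ) :
    d s ≤ d x + fderiv ℝ d x (s - x) := by
  have hc : ConcaveOn ℝ Set.univ (fun t : ℝ => d (AffineMap.lineMap x s t)) := by
    have := hconc.comp_affineMap (AffineMap.lineMap x s : ℝ →ᵃ[ℝ] (Fin m → ℝ))
    exact this
  have hd : HasDerivAt (fun t : ℝ => d (AffineMap.lineMap x s t)) (fderiv ℝ d x (s - x)) 0 := by
    have h1 : HasDerivAt (fun t : ℝ => (AffineMap.lineMap x s t : Fin m → ℝ)) (s - x) 0 :=
      AffineMap.hasDerivAt_lineMap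
    have h2 : HasFDerivAt d (fderiv ℝ d x) (AffineMap.lineMap x s (0:ℝ)) := by
      simpa using (hdiff x).hasFDerivAt
    exact h2.comp_hasDerivAt 0 h1
  have := hc.slope_le_of_hasDerivAt (Set.mem_univ 0) (Set.mem_univ 1) zero_lt_one hd
  simp [slope_def_field] at this
  simp only [map_sub]
  linarith

/-- Fejér monotonicity of the dual gradient iterates:
`‖λ⁺ − λ*‖²_W ≤ ‖λ − λ*‖²_W + 2(d(λ⁺) − d(λ*)) ≤ ‖λ − λ*‖²_W`, hence
`‖λ⁺ − λ*‖_W ≤ ‖λ − λ*‖_W`. -/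
theorem fejer_monotonicity
    (m : ℕ) (D : Set (Fin m → ℝ)) (hDne : D.Nonempty) (hDcl : IsClosed D) (hDconv : Convex ℝ D)
    (W : Matrix (Fin m) (Fin m) ℝ) (hWsym : W.IsSymm) (hWpd : W.PosDef)
    (d : (Fin m → ℝ) → ℝ) (hconc : ConcaveOn ℝ Set.univ d)
    (gradD : (Fin m → ℝ) → (Fin m → ℝ))
    (hdiff : Differentiable ℝ d)
    (hgrad : ∀ x v, fderiv ℝ d x v = ipV (gradD x) v)
    (hdescent : ∀ lam ∈ D, ∀ mu ∈ D,
      d lam ≥ d mu + ipV (gradD mu) (lam - mu) - 1 / 2 * (mNorm W (lam - mu)) ^ 2)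
    (projD : (Fin m → ℝ) → (Fin m → ℝ))
    (hprojD : ∀ x, projD x ∈ D ∧ ∀ s ∈ D, mNorm W (projD x - x) ≤ mNorm W (s - x))
    (lstar : Fin m → ℝ) (hlstarD : lstar ∈ D) (hlstarmax : ∀ mu ∈ D, d mu ≤ d lstar) :
    ∀ lam ∈ D,
      (mNorm W (projD (lam + W⁻¹.mulVec (gradD lam)) - lstar)) ^ 2 ≤
          (mNorm W (lam - lstar)) ^ 2
            + 2 * (d (projD (lam + W⁻¹.mulVec (gradD lam))) - d lstar) ∧
      (mNorm W (lam - lstar)) ^ 2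
          + 2 * (d (projD (lam + W⁻¹.mulVec (gradD lam))) - d lstar) ≤
        (mNorm W (lam - lstar)) ^ 2 ∧
      mNorm W (projD (lam + W⁻¹.mulVec (gradD lam)) - lstar) ≤ mNorm W (lam - lstar) := by
  intro lam hlam
  set x := lam + W⁻¹.mulVec (gradD lam) with hx
  obtain ⟨hpD, hpmin⟩ := hprojD x
  set p := projD x with hp
  have hWx : W.mulVec (x - lam) = gradD lam := by
    have hu : IsUnit W.det := (Matrix.isUnit_iff_isUnit_det W).1 hWpd.isUnit
    rw [hx, add_sub_cancel_left, Matrix.mulVec_mulVec, Matrix.mul_nonsing_inv W hu,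
      Matrix.one_mulVec]
  have hvar : 0 ≤ (p - x) ⬝ᵥ W.mulVec (lstar - p) := by
    apply aux_var (q := (lstar - p) ⬝ᵥ W.mulVec (lstar - p))
    intro t ht0 ht1
    have hs : p + t • (lstar - p) ∈ D := hDconv.add_smul_sub_mem hpD hlstarD ⟨ht0.le, ht1⟩
    have h1 := pow_le_pow_left₀ (Real.sqrt_nonneg _) (hpmin _ hs) 2
    have e : p + t • (lstar - p) - x = (p - x) + t • (lstar - p) := by abel
    change (mNorm W _) ^ 2 ≤ (mNorm W _) ^ 2 at h1
    rw [aux_sq hWpd, aux_sq hWpd, e] at h1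
    simp only [Matrix.mulVec_add, Matrix.mulVec_smul, dotProduct_add, add_dotProduct,
      dotProduct_smul, smul_dotProduct, smul_eq_mul] at h1
    have h2 := aux_symm hWsym (lstar - p) (p - x)
    rw [h2] at h1
    nlinarith
  have hg : ∀ y, ipV (gradD lam) y = (x - lam) ⬝ᵥ W.mulVec y := by
    intro y
    rw [aux_symm hWsym, hWx, aux_ip_dot, dotProduct_comm]
  have hdes := hdescent p hpD lam hlam
  have hcc := aux_conc hconc hdiff lam lstar
  rw [hgrad, hg] at hcc
  rw [hg, aux_sq hWpd] at hdes
  have hmain : (mNorm W (p - lstar)) ^ 2 ≤ (mNorm W (lam - lstar)) ^ 2 + 2 * (d p - d lstar) := by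
    rw [aux_sq hWpd, aux_sq hWpd]
    simp only [Matrix.mulVec_sub, dotProduct_sub, sub_dotProduct] at hvar hdes hcc ⊢
    have s1 := aux_symm hWsym p lam
    have s2 := aux_symm hWsym p lstar
    have s3 := aux_symm hWsym lam lstar
    linarith
  have hmax := hlstarmax p hpD
  refine ⟨hmain, by linarith, ?_⟩
  exact (sq_le_sq₀ (Real.sqrt_nonneg _) (Real.sqrt_nonneg _)).1 (by change (mNorm W _) ^ 2 ≤ (mNorm W _) ^ 2; linarith)
end
end

section
/- Under the stated hypotheses, for every λ ∈ D: ‖λ − r‖²_W ≤ (2θ₁²/σ) · ‖∇⁺d(λ)‖_W · ‖λ − λ̄‖_W, where r = [λ]_Λ^W and λ̄ = [λ]_{Λ*}^W. -/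
noncomputable section
open Finset

lemma aux_cs {m : ℕ} (w : Fin m → ℝ) (hw : ∀ i, 0 < w i) (x z : Fin m → ℝ) :
    ∑ i, x i * z i ≤ wNorm (fun i => (w i)⁻¹) x * wNorm w z := by
  unfold wNorm
  rw [← Real.sqrt_mul (Finset.sum_nonneg fun i _ =>
    mul_nonneg (inv_nonneg.2 (hw i).le) (sq_nonneg _))]
  apply Real.le_sqrt_of_sq_le
  apply Finset.sum_sq_le_sum_mul_sum_of_sq_eq_mul
  · intro i _; exact mul_nonneg (inv_nonneg.2 (hw i).le) (sq_nonneg _)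
  · intro i _; exact mul_nonneg (hw i).le (sq_nonneg _)
  · intro i _
    have := (hw i).ne'
    field_simp

lemma aux_cs' {m : ℕ} (w : Fin m → ℝ) (hw : ∀ i, 0 < w i) (x z : Fin m → ℝ) :
    ∑ i, w i * z i * x i ≤ wNorm w z * wNorm w x := by
  unfold wNorm
  rw [← Real.sqrt_mul (Finset.sum_nonneg fun i _ =>
    mul_nonneg (hw i).le (sq_nonneg _))]
  apply Real.le_sqrt_of_sq_le
  apply Finset.sum_sq_le_sum_mul_sum_of_sq_eq_mul
  · intro i _; exact mul_nonneg (hw i).le (sq_nonneg _)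
  · intro i _; exact mul_nonneg (hw i).le (sq_nonneg _)
  · intro i _; ring

lemma aux_eNorm_sq {m : ℕ} (x : Fin m → ℝ) : eNorm x ^ 2 = ∑ i, x i ^ 2 :=
  Real.sq_sqrt (Finset.sum_nonneg fun i _ => sq_nonneg _)

lemma aux_wNorm_neg {m : ℕ} (w x y : Fin m → ℝ) : wNorm w (x - y) = wNorm w (y - x) := by
  unfold wNorm
  congr 1
  apply Finset.sum_congr rfl
  intro i _
  simp only [Pi.sub_apply]; ring

lemma aux_mono (n m : ℕ) (σ : ℝ) (ψ : (Fin n → ℝ) → ℝ)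
    (hconv : ConvexOn ℝ Set.univ (fun x => ψ x - σ / 2 * (eNorm x) ^ 2))
    (hdiff : Differentiable ℝ ψ)
    (G : Matrix (Fin m) (Fin n) ℝ) (g : Fin m → ℝ)
    (d : (Fin m → ℝ) → ℝ)
    (hd : ∀ lam, d lam = -ψ (-(G.transpose.mulVec lam)) - ipV g lam)
    (gradD : (Fin m → ℝ) → (Fin m → ℝ))
    (hgradD : ∀ lam v, fderiv ℝ d lam v = ipV (gradD lam) v)
    (lam mu : Fin m → ℝ) :
    σ * eNorm (G.transpose.mulVec lam - G.transpose.mulVec mu) ^ 2 ≤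
      ∑ i, (gradD lam i - gradD mu i) * (mu i - lam i) := by
  set y := G.transpose.mulVec mu with hy
  set v := lam - mu with hv
  set u := G.transpose.mulVec v with hu
  have hu' : G.transpose.mulVec lam - y = u := by
    rw [hu, hv, Matrix.mulVec_sub]
  have hlin : ∀ t : ℝ, G.transpose.mulVec (mu + t • v) = y + t • u := by
    intro t; rw [Matrix.mulVec_add, Matrix.mulVec_smul]
  have hdd : Differentiable ℝ d := by
    have : d = fun lam => -ψ (-(G.transpose.mulVecLin lam)) - ipV g lam := by
      funext l; rw [hd, Matrix.mulVecLin_apply]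
    rw [this]
    have h1 : Differentiable ℝ (fun l => G.transpose.mulVecLin l) :=
      (LinearMap.toContinuousLinearMap G.transpose.mulVecLin).differentiable
    unfold ipV
    exact ((hdiff.comp h1.neg).neg).sub (by fun_prop)
  set φ : ℝ → ℝ := fun t => -d (mu + t • v) - σ / 2 * eNorm (y + t • u) ^ 2 with hφ
  have hφc : ConvexOn ℝ Set.univ φ := by
    have e : φ = fun t => (fun x => ψ x - σ / 2 * (eNorm x) ^ 2) (-(y + t • u))
        + (ipV g mu + t * ipV g v) := by
      funext t
      have e1 : eNorm (-(y + t • u)) = eNorm (y + t • u) := by simp only [eNorm, Pi.neg_apply, neg_sq]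
      have e2 : ipV g (mu + t • v) = ipV g mu + t * ipV g v := by
        simp only [ipV, Finset.mul_sum, ← Finset.sum_add_distrib]
        apply Finset.sum_congr rfl
        intro i _; simp; ring
      simp only [hφ, hd, hlin, e1, e2]; ring
    rw [e]
    refine ⟨convex_univ, ?_⟩
    intro s _ t _ a b ha hb hab
    have := hconv.2 (Set.mem_univ (-(y + s • u))) (Set.mem_univ (-(y + t • u))) ha hb hab
    have e3 : a • (-(y + s • u)) + b • (-(y + t • u)) = -(y + (a • s + b • t) • u) := by
      have hb' : b = 1 - a := by linarith
      subst hb'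
      module
    rw [e3] at this
    simp only [smul_eq_mul] at this ⊢
    have hb' : b = 1 - a := by linarith
    subst hb'
    linarith
  have hder : ∀ t, HasDerivAt φ (-ipV (gradD (mu + t • v)) v
      - σ / 2 * ∑ i, 2 * (y i + t * u i) * u i) t := by
    intro t
    have h1 : HasDerivAt (fun t : ℝ => mu + t • v) v t := by
      simpa using ((hasDerivAt_id t).smul_const v).const_add mu
    have h2 := (hdd (mu + t • v)).hasFDerivAt.comp_hasDerivAt t h1
    rw [hgradD] at h2
    have h3 : HasDerivAt (fun t => eNorm (y + t • u) ^ 2) (∑ i, 2 * (y i + t * u i) * u i) t := by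
      simp only [aux_eNorm_sq]
      apply HasDerivAt.fun_sum
      intro i _
      have h4 : HasDerivAt (fun t : ℝ => y i + t * u i) (u i) t := by
        simpa using ((hasDerivAt_id t).mul_const (u i)).const_add (y i)
      simpa using h4.fun_pow 2
    exact h2.neg.sub (h3.const_mul _)
  have key := (hφc.le_slope_of_hasDerivAt (Set.mem_univ 0) (Set.mem_univ 1) zero_lt_one (hder 0)).trans
    (hφc.slope_le_of_hasDerivAt (Set.mem_univ 0) (Set.mem_univ 1) zero_lt_one (hder 1))
  rw [hu', aux_eNorm_sq]
  have e0 : mu + (0:ℝ) • v = mu := by simp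
  have e1 : mu + (1:ℝ) • v = lam := by simp [hv]
  rw [e0, e1] at key
  have s1 : ∑ i, 2 * (y i + 1 * u i) * u i = ∑ i, 2 * (y i + 0 * u i) * u i
      + 2 * ∑ i, u i ^ 2 := by
    rw [Finset.mul_sum, ← Finset.sum_add_distrib]
    apply Finset.sum_congr rfl
    intro i _; ring
  have s2 : ∑ i, (gradD lam i - gradD mu i) * (mu i - lam i)
      = ipV (gradD mu) v - ipV (gradD lam) v := by
    simp only [ipV, ← Finset.sum_sub_distrib]
    apply Finset.sum_congr rfl
    intro i _; simp [hv]; ring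
  rw [s1] at key
  rw [s2]
  linarith

/-- Lemma: bound on `‖λ − r‖²_W` with `r = [λ]_Λ^W`:
`‖λ − r‖²_W ≤ (2θ₁²/σ)‖∇⁺d(λ)‖_W ‖λ − λ̄‖_W` for all `λ ∈ D`. -/
theorem distance_to_face_bound
    (n p q : ℕ) (σ θ₁ : ℝ) (hσ : 0 < σ) (hθ₁ : 0 < θ₁)
    (ψ : (Fin n → ℝ) → ℝ)
    (hconv : ConvexOn ℝ Set.univ (fun x => ψ x - σ / 2 * (eNorm x) ^ 2))
    (hdiff : Differentiable ℝ ψ)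
    (G : Matrix (Fin (p + q)) (Fin n) ℝ) (g : Fin (p + q) → ℝ)
    (W : Fin (p + q) → ℝ) (hW : ∀ i, 0 < W i)
    (d : (Fin (p + q) → ℝ) → ℝ)
    (hd : ∀ lam, d lam = -ψ (-(G.transpose.mulVec lam)) - ipV g lam)
    (gradD : (Fin (p + q) → ℝ) → (Fin (p + q) → ℝ))
    (hgradD : ∀ lam v, fderiv ℝ d lam v = ipV (gradD lam) v)
    (Lstar : Set (Fin (p + q) → ℝ))
    (hLstar : ∀ l, l ∈ Lstar ↔ (l ∈ Dpq p q ∧ ∀ mu ∈ Dpq p q, d mu ≤ d l))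
    (hLne : Lstar.Nonempty) (hLcl : IsClosed Lstar)
    (ystar : Fin n → ℝ) (hystar : ∀ l ∈ Lstar, G.transpose.mulVec l = ystar)
    (projL : (Fin (p + q) → ℝ) → (Fin (p + q) → ℝ))
    (hprojL : ∀ x, projL x ∈ {lam | lam ∈ Dpq p q ∧ G.transpose.mulVec lam = ystar} ∧
      ∀ s ∈ {lam | lam ∈ Dpq p q ∧ G.transpose.mulVec lam = ystar},
        wNorm W (projL x - x) ≤ wNorm W (s - x))
    (projLs : (Fin (p + q) → ℝ) → (Fin (p + q) → ℝ))
    (hprojLs : ∀ x, projLs x ∈ Lstar ∧ ∀ s ∈ Lstar, wNorm W (projLs x - x) ≤ wNorm W (s - x))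
    (hHoffman : ∀ lam ∈ Dpq p q,
      wNorm W (lam - projL lam) ≤ θ₁ * eNorm (G.transpose.mulVec lam - ystar))
    (hnonexp : ∀ lam ∈ Dpq p q, ∀ om ∈ Dpq p q,
      wNorm (fun i => (W i)⁻¹) (gradD lam - gradD om) ≤ wNorm W (lam - om))
    (hfix : ∀ l ∈ Lstar, projDpq p q (l + fun i => (W i)⁻¹ * gradD l i) - l = 0) :
    ∀ lam ∈ Dpq p q,
      (wNorm W (lam - projL lam)) ^ 2 ≤
        2 * θ₁ ^ 2 / σ * wNorm W (projDpq p q (lam + fun i => (W i)⁻¹ * gradD lam i) - lam)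
          * wNorm W (lam - projLs lam) := by
  intro lam hlam
  set mu := projLs lam with hmu
  have hmuS : mu ∈ Lstar := (hprojLs lam).1
  have hmuD : mu ∈ Dpq p q := ((hLstar mu).1 hmuS).1
  set z := projDpq p q (lam + fun i => (W i)⁻¹ * gradD lam i) - lam with hz
  have hmono := aux_mono n (p + q) σ ψ hconv hdiff G g d hd gradD hgradD lam mu
  rw [hystar mu hmuS] at hmono
  have hH := hHoffman lam hlam
  have hN := hnonexp lam hlam mu hmuD
  have hfx := hfix mu hmuS
  have c1 := aux_cs W hW (gradD lam - gradD mu) z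
  have c2 := aux_cs' W hW (mu - lam) z
  rw [aux_wNorm_neg W mu lam] at c2
  have hz0 : 0 ≤ wNorm W z := Real.sqrt_nonneg _
  have c3 : wNorm (fun i => (W i)⁻¹) (gradD lam - gradD mu) * wNorm W z
      ≤ wNorm W (lam - mu) * wNorm W z := mul_le_mul_of_nonneg_right hN hz0
  have pt : ∀ i, (gradD lam i - gradD mu i) * (mu i - lam i) ≤
      (gradD lam - gradD mu) i * z i + W i * z i * (mu - lam) i := by
    intro i
    have hwi := hW i
    have hzi : z i = (if (i : ℕ) < p then lam i + (W i)⁻¹ * gradD lam i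
      else max (lam i + (W i)⁻¹ * gradD lam i) 0) - lam i := rfl
    have hfi : (if (i : ℕ) < p then mu i + (W i)⁻¹ * gradD mu i
      else max (mu i + (W i)⁻¹ * gradD mu i) 0) - mu i = 0 := congrFun hfx i
    simp only [Pi.sub_apply]
    obtain ⟨a, ha⟩ : ∃ a, a = (W i)⁻¹ * gradD lam i := ⟨_, rfl⟩
    obtain ⟨b, hb⟩ : ∃ b, b = (W i)⁻¹ * gradD mu i := ⟨_, rfl⟩
    have ga : gradD lam i = W i * a := by rw [ha]; field_simp
    have gb : gradD mu i = W i * b := by rw [hb]; field_simp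
    rw [← ha] at hzi
    rw [← hb] at hfi
    rw [ga, gb]
    suffices h : (a - b) * (mu i - lam i) ≤ (a - b) * z i + z i * (mu i - lam i) by
      nlinarith [mul_le_mul_of_nonneg_left h hwi.le]
    by_cases hip : (i : ℕ) < p
    · rw [if_pos hip] at hzi hfi
      have : b = 0 := by linarith
      have hza : z i = a := by linarith
      rw [this, hza]; nlinarith [sq_nonneg a]
    · rw [if_neg hip] at hzi hfi
      have hl := hlam i (not_lt.1 hip)
      have hm := hmuD i (not_lt.1 hip)
      -- projection inequalities
      have k1 : (a - z i) * (mu i - (lam i + z i)) ≤ 0 := by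
        rcases le_total (lam i + a) 0 with h | h
        · rw [max_eq_right h] at hzi
          apply mul_nonpos_of_nonpos_of_nonneg <;> linarith
        · rw [max_eq_left h] at hzi
          have : a - z i = 0 := by linarith
          rw [this]; simp
      have hlz : 0 ≤ lam i + z i := by
        have := le_max_right (lam i + a) 0
        linarith
      have k2 : b * (lam i + z i - mu i) ≤ 0 := by
        rcases le_total (mu i + b) 0 with h | h
        · rw [max_eq_right h] at hfi
          apply mul_nonpos_of_nonpos_of_nonneg <;> linarith
        · rw [max_eq_left h] at hfi
          have : b = 0 := by linarith
          rw [this]; simp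
      nlinarith [sq_nonneg (z i)]
  have hsum := Finset.sum_le_sum (fun i (_ : i ∈ Finset.univ) => pt i)
  rw [Finset.sum_add_distrib] at hsum
  have hE : eNorm (G.transpose.mulVec lam - ystar) ^ 2 ≤
      2 / σ * wNorm W z * wNorm W (lam - mu) := by
    have : σ * eNorm (G.transpose.mulVec lam - ystar) ^ 2 ≤ 2 * wNorm W z * wNorm W (lam - mu) := by
      linarith
    calc _ ≤ (2 * wNorm W z * wNorm W (lam - mu)) / σ := by
          rw [le_div_iff₀ hσ]; linarith
      _ = _ := by ring
  calc wNorm W (lam - projL lam) ^ 2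
      ≤ (θ₁ * eNorm (G.transpose.mulVec lam - ystar)) ^ 2 :=
        pow_le_pow_left₀ (Real.sqrt_nonneg _) hH 2
    _ = θ₁ ^ 2 * eNorm (G.transpose.mulVec lam - ystar) ^ 2 := by ring
    _ ≤ θ₁ ^ 2 * (2 / σ * wNorm W z * wNorm W (lam - mu)) :=
        mul_le_mul_of_nonneg_left hE (sq_nonneg _)
    _ = _ := by ring
end
end
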